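/- Let (C,V) be an approval election with voters v_1,…,v_n that is VI with respect to the order v_1,…,v_n, let k be a committee size with 1 ≤ k ≤ |C|, p ∈ C, B ∈ ℕ, and for every voter v and candidate c ∈ ballot(v) let π(v,c) ∈ ℕ be the price of deleting c from v's ballot. Let s = score(p), call a candidate c superior if score(c) > s, and for a superior candidate c approved exactly by v_a,…,v_b with t_c = score(c) − s define cost(c) = min over i ∈ {0,…,t_c} of the total price of deleting c from the first i voters v_a,…,v_{a+i−1} and the last t_c − i voters v_{b−(t_c−i)+1},…,v_b of its interval. Let S be the number of superior candidates. Then there exists a deletion bribery of total price at most B — i.e., new ballots ballot'(v) ⊆ ballot(v) whose total deleted price is at most B, such that the new election is still VI with respect to v_1,…,v_n and p belongs to some AV winning committee of size k — if and only if either S ≤ k − 1, or S > k − 1 and the sum of the S − (k−1) smallest values cost(c) over superior candidates c is at most B. -/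

import Mathlib

/-- The approval score of candidate `c` when the voters are `v_1, …, v_n`. -/
def avScore {α : Type*} [DecidableEq α] (n : ℕ) (ballot : ℕ → Finset α) (c : α) : ℕ :=
  ((Finset.Icc 1 n).filter fun v => c ∈ ballot v).card

/-- The election with voters `v_1, …, v_n` is VI (voter interval) with respect to this order. -/
def VoterInterval {α : Type*} (n : ℕ) (C : Finset α) (ballot : ℕ → Finset α) : Prop :=
  ∀ c ∈ C, ∀ u ∈ Finset.Icc 1 n, ∀ w ∈ Finset.Icc 1 n, ∀ v ∈ Finset.Icc 1 n,
    u ≤ v → v ≤ w → c ∈ ballot u → c ∈ ballot w → c ∈ ballot v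

/-- Candidate `p` belongs to some AV winning committee of size `k`. -/
def InWinningCommittee {α : Type*} [DecidableEq α] (n : ℕ) (C : Finset α)
    (ballot : ℕ → Finset α) (k : ℕ) (p : α) : Prop :=
  ∃ W ⊆ C, W.card = k ∧ p ∈ W ∧
    ∀ W' ⊆ C, W'.card = k → ∑ c ∈ W', avScore n ballot c ≤ ∑ c ∈ W, avScore n ballot c

/-- For a candidate `c` approved exactly by the voters `v_a, …, v_b`, with `tc` approvals to
delete: the cheapest way of deleting `c` from the first `i` and the last `tc - i` voters of
its interval, minimized over `i ∈ {0, …, tc}`. -/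
noncomputable def delCost {α : Type*} (π : ℕ → α → ℕ) (a b tc : ℕ) (c : α) : ℕ :=
  sInf { z : ℕ | ∃ i ≤ tc,
    z = (∑ v ∈ Finset.Ico a (a + i), π v c) + (∑ v ∈ Finset.Ioc (b - (tc - i)) b, π v c) }

/-- The price paid, summed over the voters, equals the price paid, summed over the candidates. -/
theorem sum_deleted_comm {α : Type*} [DecidableEq α] (C : Finset α) (n : ℕ)
    (ballot ballot' : ℕ → Finset α) (hsub : ∀ v ∈ Finset.Icc 1 n, ballot v ⊆ C)
    (π : ℕ → α → ℕ) :
    (∑ v ∈ Finset.Icc 1 n, ∑ c ∈ ballot v \ ballot' v, π v c) =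
      ∑ c ∈ C, ∑ v ∈ (Finset.Icc 1 n).filter (fun v => c ∈ ballot v \ ballot' v), π v c := by
  apply Finset.sum_comm'
  intro v c
  simp only [Finset.mem_filter, Finset.mem_sdiff]
  constructor
  · rintro ⟨hv, hc, hc'⟩
    exact ⟨⟨hv, hc, hc'⟩, hsub v hv hc⟩
  · rintro ⟨⟨hv, hc, hc'⟩, -⟩
    exact ⟨hv, hc, hc'⟩

theorem sum_insert_erase {α : Type*} [DecidableEq α] (W : Finset α) (f : α → ℕ) {x y : α}
    (hx : x ∈ W) (hy : y ∉ W) :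
    (∑ c ∈ insert y (W.erase x), f c) + f x = (∑ c ∈ W, f c) + f y := by
  rw [Finset.sum_insert (fun h => hy (Finset.mem_of_mem_erase h)), ← Finset.sum_erase_add W f hx]
  ring

theorem card_insert_erase {α : Type*} [DecidableEq α] (W : Finset α) {x y : α}
    (hx : x ∈ W) (hy : y ∉ W) : (insert y (W.erase x)).card = W.card := by
  rw [Finset.card_insert_of_notMem (fun h => hy (Finset.mem_of_mem_erase h)),
    Finset.card_erase_add_one hx]

/-- A candidate is in a winning committee iff fewer than `k` candidates have a larger score. -/
theorem inWinningCommittee_iff {α : Type*} [DecidableEq α] (n : ℕ) (C : Finset α)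
    (ballot : ℕ → Finset α) (k : ℕ) (hk1 : 1 ≤ k) (hk2 : k ≤ C.card) (p : α) (hp : p ∈ C) :
    InWinningCommittee n C ballot k p ↔
      (C.filter fun c => avScore n ballot p < avScore n ballot c).card ≤ k - 1 := by
  constructor
  · rintro ⟨W, hWC, hWk, hpW, hmax⟩
    rw [← hWk, ← Finset.card_erase_of_mem hpW]
    apply Finset.card_le_card
    intro c hc
    rw [Finset.mem_filter] at hc
    by_contra hcW
    have hcp : c ≠ p := by
      rintro rfl
      exact lt_irrefl _ hc.2
    have hcW : c ∉ W := fun h => hcW (Finset.mem_erase.2 ⟨hcp, h⟩)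
    have hle := hmax (insert c (W.erase p))
      (Finset.insert_subset hc.1 ((Finset.erase_subset _ _).trans hWC))
      ((card_insert_erase W hpW hcW).trans hWk)
    have hsum := sum_insert_erase W (avScore n ballot) hpW hcW
    have := hc.2
    omega
  · intro hcard
    obtain ⟨W, hW, hmax⟩ := Finset.exists_max_image (C.powersetCard k)
      (fun W => ∑ c ∈ W, avScore n ballot c) (Finset.powersetCard_nonempty.2 hk2)
    simp only [Finset.mem_powersetCard] at hW hmax
    by_cases hpW : p ∈ W
    · exact ⟨W, hW.1, hW.2, hpW, fun W' h1 h2 => hmax W' ⟨h1, h2⟩⟩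
    · obtain ⟨c, hcW, hc⟩ : ∃ c ∈ W,
          c ∉ C.filter fun c => avScore n ballot p < avScore n ballot c :=
        Finset.exists_mem_notMem_of_card_lt_card (by omega)
      have hcle : avScore n ballot c ≤ avScore n ballot p := by
        by_contra h
        exact hc (Finset.mem_filter.2 ⟨hW.1 hcW, not_le.1 h⟩)
      have hsum := sum_insert_erase W (avScore n ballot) hcW hpW
      refine ⟨insert p (W.erase c),
        Finset.insert_subset hp ((Finset.erase_subset _ _).trans hW.1),
        (card_insert_erase W hcW hpW).trans hW.2, Finset.mem_insert_self _ _, ?_⟩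
      intro W' h1 h2
      have := hmax W' ⟨h1, h2⟩
      omega

theorem exists_delCost_eq {α : Type*} (π : ℕ → α → ℕ) (a b t : ℕ) (c : α) :
    ∃ i ≤ t, delCost π a b t c =
      (∑ v ∈ Finset.Ico a (a + i), π v c) + (∑ v ∈ Finset.Ioc (b - (t - i)) b, π v c) :=
  Nat.sInf_mem (s := { z : ℕ | ∃ i ≤ t, z = (∑ v ∈ Finset.Ico a (a + i), π v c) +
    (∑ v ∈ Finset.Ioc (b - (t - i)) b, π v c) }) ⟨_, t, le_rfl, rfl⟩

/-- Deleting enough voters at the two ends of an interval costs at least `delCost`. -/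
theorem delCost_le_sum {α : Type*} (π : ℕ → α → ℕ) {a b t i : ℕ} (c : α) (hi : i ≤ t)
    (ht : a + t ≤ b + 1) {D : Finset ℕ} (hleft : Finset.Ico a (a + i) ⊆ D)
    (hright : Finset.Ioc (b - (t - i)) b ⊆ D) :
    delCost π a b t c ≤ ∑ v ∈ D, π v c := by
  have hle : delCost π a b t c ≤
      (∑ v ∈ Finset.Ico a (a + i), π v c) + (∑ v ∈ Finset.Ioc (b - (t - i)) b, π v c) :=
    Nat.sInf_le ⟨i, hi, rfl⟩
  refine hle.trans ?_
  rw [← Finset.sum_union]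
  · exact Finset.sum_le_sum_of_subset (Finset.union_subset hleft hright)
  · rw [Finset.disjoint_left]
    intro v h1 h2
    simp only [Finset.mem_Ico, Finset.mem_Ioc] at h1 h2
    omega

theorem delCost_le_sum_sdiff {α : Type*} (π : ℕ → α → ℕ) {a b t : ℕ} (c : α) (ha : 1 ≤ a)
    {K : Finset ℕ} (hK : K ⊆ Finset.Icc a b)
    (hconv : ∀ u ∈ K, ∀ w ∈ K, ∀ v, u ≤ v → v ≤ w → v ∈ K)
    (hcard : K.card + t + a ≤ b + 1) :
    delCost π a b t c ≤ ∑ v ∈ Finset.Icc a b \ K, π v c := by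
  rcases K.eq_empty_or_nonempty with rfl | hne
  · refine delCost_le_sum π c (le_refl t) (by omega) ?_ ?_ <;>
    · intro v hv
      simp only [Finset.mem_Ico, Finset.mem_Ioc, Finset.sdiff_empty, Finset.mem_Icc] at *
      omega
  · have hm := K.min'_mem hne
    have hM := K.max'_mem hne
    have hle : ∀ v ∈ K, K.min' hne ≤ v := fun v hv => K.min'_le v hv
    have hge : ∀ v ∈ K, v ≤ K.max' hne := fun v hv => K.le_max' v hv
    generalize K.min' hne = m at *
    generalize K.max' hne = M at *
    obtain rfl : K = Finset.Icc m M := by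
      ext v
      rw [Finset.mem_Icc]
      exact ⟨fun hv => ⟨hle v hv, hge v hv⟩, fun hv => hconv m hm M hM v hv.1 hv.2⟩
    have hm' := hK hm
    have hM' := hK hM
    rw [Nat.card_Icc] at hcard
    rw [Finset.mem_Icc] at hm hM hm' hM'
    refine delCost_le_sum (i := min t (m - a)) π c (min_le_left _ _) (by omega) ?_ ?_ <;>
    · intro v hv
      simp only [Finset.mem_Ico, Finset.mem_Ioc, Finset.mem_sdiff, Finset.mem_Icc] at *
      omega

/-- The score of a candidate approved by the voters `v_a, …, v_b`. -/
theorem avScore_eq_of_interval {α : Type*} [DecidableEq α] {n : ℕ} {ballot : ℕ → Finset α}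
    {c : α} {a b : ℕ} (ha : 1 ≤ a) (hb : b ≤ n)
    (h : ∀ v ∈ Finset.Icc 1 n, (c ∈ ballot v ↔ a ≤ v ∧ v ≤ b)) :
    avScore n ballot c = b + 1 - a := by
  rw [← Nat.card_Icc, avScore]
  congr 1
  ext v
  rw [Finset.mem_filter, Finset.mem_Icc, Finset.mem_Icc]
  constructor
  · rintro ⟨hv, hc⟩
    exact (h v (Finset.mem_Icc.2 hv)).1 hc
  · intro hv
    have hv' : 1 ≤ v ∧ v ≤ n := by omega
    exact ⟨hv', (h v (Finset.mem_Icc.2 hv')).2 hv⟩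

theorem avScore_mono {α : Type*} [DecidableEq α] {n : ℕ} {ballot ballot' : ℕ → Finset α}
    (h : ∀ v ∈ Finset.Icc 1 n, ballot' v ⊆ ballot v) (c : α) :
    avScore n ballot' c ≤ avScore n ballot c := by
  apply Finset.card_le_card
  intro v hv
  rw [Finset.mem_filter] at hv ⊢
  exact ⟨hv.1, h v hv.1 hv.2⟩

theorem avScore_congr {α : Type*} [DecidableEq α] {n : ℕ} {ballot ballot' : ℕ → Finset α} {c : α}
    (h : ∀ v ∈ Finset.Icc 1 n, (c ∈ ballot' v ↔ c ∈ ballot v)) :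
    avScore n ballot' c = avScore n ballot c := by
  rw [avScore, avScore, Finset.filter_congr h]

/-- Lowering the score of `c` by at least `t` within VI elections costs at least `delCost`. -/
theorem delCost_le_sum_deleted {α : Type*} [DecidableEq α] {C : Finset α} {n : ℕ}
    {ballot ballot' : ℕ → Finset α} (hdel : ∀ v ∈ Finset.Icc 1 n, ballot' v ⊆ ballot v)
    (hVI : VoterInterval n C ballot') (π : ℕ → α → ℕ) {c : α} (hc : c ∈ C) {a b t : ℕ}
    (ha : 1 ≤ a) (hb : b ≤ n) (h : ∀ v ∈ Finset.Icc 1 n, (c ∈ ballot v ↔ a ≤ v ∧ v ≤ b))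
    (hpos : 0 < avScore n ballot c) (ht : avScore n ballot' c + t ≤ avScore n ballot c) :
    delCost π a b t c ≤
      ∑ v ∈ (Finset.Icc 1 n).filter (fun v => c ∈ ballot v \ ballot' v), π v c := by
  rw [avScore_eq_of_interval ha hb h] at hpos ht
  have hsub : Finset.Icc a b \ (Finset.Icc 1 n).filter (fun v => c ∈ ballot' v) =
      (Finset.Icc 1 n).filter (fun v => c ∈ ballot v \ ballot' v) := by
    ext v
    simp only [Finset.mem_sdiff, Finset.mem_filter, Finset.mem_Icc] at h ⊢
    have := h v
    grind
  rw [← hsub]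
  apply delCost_le_sum_sdiff π c ha
  · intro v hv
    rw [Finset.mem_filter] at hv
    exact Finset.mem_Icc.2 ((h v hv.1).1 (hdel v hv.1 hv.2))
  · intro u hu w hw v huv hvw
    rw [Finset.mem_filter] at hu hw ⊢
    have hv : v ∈ Finset.Icc 1 n := by
      have h1 := hu.1
      have h2 := hw.1
      rw [Finset.mem_Icc] at h1 h2 ⊢
      omega
    exact ⟨hv, hVI c hc u hu.1 w hw.1 v hv huv hvw hu.2 hw.2⟩
  · rw [avScore] at ht
    omega

/-- Correctness of the algorithm for priced bribery by deleting approvals in VI elections. -/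
theorem delApprovals_VI_bribery {α : Type*} [DecidableEq α]
    (C : Finset α) (n : ℕ) (hn : 1 ≤ n) (ballot : ℕ → Finset α)
    (hsub : ∀ v ∈ Finset.Icc 1 n, ballot v ⊆ C)
    (hVI : VoterInterval n C ballot)
    (k : ℕ) (hk1 : 1 ≤ k) (hk2 : k ≤ C.card)
    (p : α) (hp : p ∈ C) (B : ℕ) (π : ℕ → α → ℕ)
    (aEnd bEnd : α → ℕ)
    (hend : ∀ c ∈ C, avScore n ballot p < avScore n ballot c →
      1 ≤ aEnd c ∧ bEnd c ≤ n ∧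
        ∀ v ∈ Finset.Icc 1 n, (c ∈ ballot v ↔ aEnd c ≤ v ∧ v ≤ bEnd c)) :
    (∃ ballot' : ℕ → Finset α,
        (∀ v ∈ Finset.Icc 1 n, ballot' v ⊆ ballot v) ∧
        (∑ v ∈ Finset.Icc 1 n, ∑ c ∈ ballot v \ ballot' v, π v c) ≤ B ∧
        VoterInterval n C ballot' ∧
        InWinningCommittee n C ballot' k p)
      ↔ ((C.filter fun c => avScore n ballot p < avScore n ballot c).card ≤ k - 1 ∨
          (k - 1 < (C.filter fun c => avScore n ballot p < avScore n ballot c).card ∧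
            ∃ T ⊆ C.filter fun c => avScore n ballot p < avScore n ballot c,
              T.card =
                (C.filter fun c => avScore n ballot p < avScore n ballot c).card - (k - 1) ∧
              (∑ c ∈ T,
                delCost π (aEnd c) (bEnd c)
                  (avScore n ballot c - avScore n ballot p) c) ≤ B)) := by
  set s := avScore n ballot p with hs
  set A := C.filter fun c => s < avScore n ballot c with hA
  constructor
  · rintro ⟨ballot', hdel, hprice, hVI', hwin⟩
    rw [inWinningCommittee_iff n C ballot' k hk1 hk2 p hp] at hwin
    rcases le_or_gt A.card (k - 1) with hS | hS
    · exact Or.inl hS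
    refine Or.inr ⟨hS, ?_⟩
    set A' := C.filter fun c => avScore n ballot' p < avScore n ballot' c
    have hcard : A.card - (k - 1) ≤ (A \ A').card :=
      (Nat.sub_le_sub_left hwin _).trans (Finset.le_card_sdiff A' A)
    obtain ⟨T, hTA, hT⟩ := Finset.exists_subset_card_eq hcard
    refine ⟨T, hTA.trans Finset.sdiff_subset, hT, le_trans ?_ hprice⟩
    rw [sum_deleted_comm C n ballot ballot' hsub]
    have hTC : T ⊆ C := (hTA.trans Finset.sdiff_subset).trans (Finset.filter_subset _ _)
    refine le_trans (Finset.sum_le_sum fun c hc => ?_) (Finset.sum_le_sum_of_subset hTC)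
    obtain ⟨hcA, hcA'⟩ := Finset.mem_sdiff.1 (hTA hc)
    obtain ⟨hcC, hcs⟩ := Finset.mem_filter.1 hcA
    obtain ⟨ha, hb, hab⟩ := hend c hcC hcs
    have hle : avScore n ballot' c ≤ avScore n ballot' p := by
      by_contra hlt
      exact hcA' (Finset.mem_filter.2 ⟨hcC, not_le.1 hlt⟩)
    have := avScore_mono hdel p
    exact delCost_le_sum_deleted hdel hVI' π hcC ha hb hab (by omega) (by omega)
  · rintro (hS | ⟨hS, T, hTA, hT, hcost⟩)
    · exact ⟨ballot, fun v _ => Finset.Subset.refl _, by simp, hVI,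
        (inWinningCommittee_iff n C ballot k hk1 hk2 p hp).2 hS⟩
    choose i hi hcost_eq using fun c =>
      exists_delCost_eq π (aEnd c) (bEnd c) (avScore n ballot c - s) c
    have hTC : T ⊆ C := hTA.trans (Finset.filter_subset _ _)
    have hTs : ∀ c ∈ T, s < avScore n ballot c := fun c hc => (Finset.mem_filter.1 (hTA hc)).2
    have hlen : ∀ c ∈ T, avScore n ballot c = bEnd c + 1 - aEnd c := fun c hc =>
      have h := hend c (hTC hc) (hTs c hc)
      avScore_eq_of_interval h.1 h.2.1 h.2.2
    set ballot' : ℕ → Finset α := fun v => (ballot v).filter fun c =>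
      c ∈ T → aEnd c + i c ≤ v ∧ v ≤ bEnd c - (avScore n ballot c - s - i c) with hballot'
    have hdel : ∀ v ∈ Finset.Icc 1 n, ballot' v ⊆ ballot v := fun v _ => Finset.filter_subset _ _
    have hmemT : ∀ c ∈ T, ∀ v ∈ Finset.Icc 1 n, (c ∈ ballot' v ↔
        aEnd c + i c ≤ v ∧ v ≤ bEnd c - (avScore n ballot c - s - i c)) := by
      intro c hc v hv
      have := (hend c (hTC hc) (hTs c hc)).2.2 v hv
      simp only [hballot', Finset.mem_filter]
      constructor
      · exact fun h => h.2 hc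
      · exact fun h => ⟨this.2 (by omega), fun _ => h⟩
    have hmem : ∀ c ∉ T, ∀ v, (c ∈ ballot' v ↔ c ∈ ballot v) := by
      intro c hc v
      simp [hballot', hc]
    have hscore : ∀ c ∉ T, avScore n ballot' c = avScore n ballot c := fun c hc =>
      avScore_congr fun v _ => hmem c hc v
    have hscoreT : ∀ c ∈ T, avScore n ballot' c = s := by
      intro c hc
      have h := hend c (hTC hc) (hTs c hc)
      have h1 := hlen c hc
      have h2 := hTs c hc
      have h3 := hi c
      rw [avScore_eq_of_interval (by omega) (by omega) (hmemT c hc)]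
      omega
    have hpT : p ∉ T := fun h => lt_irrefl _ (hTs p h)
    refine ⟨ballot', hdel, ?_, ?_, ?_⟩
    · refine le_trans (le_of_eq ?_) hcost
      rw [sum_deleted_comm C n ballot ballot' hsub, ← Finset.sum_subset hTC]
      · refine Finset.sum_congr rfl fun c hc => ?_
        have h1 := hlen c hc
        have h2 := hTs c hc
        have h3 := hi c
        obtain ⟨ha, hb, hab⟩ := hend c (hTC hc) h2
        rw [hcost_eq c, ← Finset.sum_union]
        · refine Finset.sum_congr ?_ fun _ _ => rfl
          ext v
          rw [Finset.mem_filter, Finset.mem_sdiff, Finset.mem_union, Finset.mem_Ico,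
            Finset.mem_Ioc]
          constructor
          · rintro ⟨hv, hcv, hcv'⟩
            rw [hmemT c hc v hv] at hcv'
            rw [hab v hv] at hcv
            omega
          · intro hv
            have hv' : v ∈ Finset.Icc 1 n := Finset.mem_Icc.2 (by omega)
            rw [hmemT c hc v hv', hab v hv']
            exact ⟨hv', by omega, by omega⟩
        · rw [Finset.disjoint_left]
          intro v hv hv'
          rw [Finset.mem_Ico] at hv
          rw [Finset.mem_Ioc] at hv'
          omega
      · intro c _ hc
        rw [Finset.filter_false_of_mem, Finset.sum_empty]
        intro v _ hv
        rw [Finset.mem_sdiff, hmem c hc v] at hv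
        exact hv.2 hv.1
    · intro c hc u hu w hw v hv huv hvw hcu hcw
      by_cases hcT : c ∈ T
      · rw [hmemT c hcT _ hu] at hcu
        rw [hmemT c hcT _ hw] at hcw
        rw [hmemT c hcT _ hv]
        omega
      · rw [hmem c hcT] at hcu hcw ⊢
        exact hVI c hc u hu w hw v hv huv hvw hcu hcw
    · rw [inWinningCommittee_iff n C ballot' k hk1 hk2 p hp, hscore p hpT]
      have hsubset : (C.filter fun c => s < avScore n ballot' c) ⊆ A \ T := by
        intro c hc
        obtain ⟨hcC, hcs⟩ := Finset.mem_filter.1 hc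
        have hcT : c ∉ T := fun h => by
          rw [hscoreT c h] at hcs
          exact lt_irrefl _ hcs
        rw [hscore c hcT] at hcs
        exact Finset.mem_sdiff.2 ⟨Finset.mem_filter.2 ⟨hcC, hcs⟩, hcT⟩
      refine (Finset.card_le_card hsubset).trans ?_
      rw [Finset.card_sdiff_of_subset hTA, hT]
      omega
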